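/- Let N ≥ 2 be an integer, p a real with 1 < p < N, k ≥ 1 an integer and α := α(k). Let Φ : ℝ^N → ℝ be a nonzero polynomial function which is homogeneous of degree k and harmonic (its Laplacian vanishes identically on ℝ^N). Define v : ℝ^N → ℝ by v(x) := |x|^{(p+α)/(p(p−1))} (1 + |x|^{(p+α)/(p−1)})^{−(N+α)/(p+α)} Φ(x/|x|) for x ≠ 0 and v(0) := 0. Then v is continuous on ℝ^N, continuously differentiable on ℝ^N∖{0}, and v is a weak solution of the linearized equation at U_α: for every φ ∈ C_c^∞(ℝ^N), ∫_{ℝ^N} [ |∇U_α|^{p−2} ∇v·∇φ + (p−2)|∇U_α|^{p−4}(∇U_α·∇v)(∇U_α·∇φ) ] dx = (p*_α−1) ∫_{ℝ^N} |x|^α U_α(x)^{p*_α−2} v(x) φ(x) dx, all integrals being absolutely convergent. -/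

import Mathlib

open MeasureTheory Real
open scoped RealInnerProductSpace Classical

noncomputable section

/-- The critical Hénon exponent `p*_α = p(N+α)/(N-p)`. -/
def pS (N p α : ℝ) : ℝ := p * (N + α) / (N - p)

/-- The normalizing constant `C_{N,p,α}`. -/
def Cnpa (N p α : ℝ) : ℝ :=
  ((N + α) * ((N - p) / (p - 1)) ^ (p - 1)) ^ ((N - p) / (p * (p + α)))

/-- The radial profile `U_α(r)` of the standard solution. -/
def Urad (N p α r : ℝ) : ℝ :=
  Cnpa N p α * (1 + r ^ ((p + α) / (p - 1))) ^ (-((N - p) / (p + α)))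

/-- The standard solution `U_α` on `ℝ^N`. -/
def Ufun (N : ℕ) (p α : ℝ) (x : EuclideanSpace ℝ (Fin N)) : ℝ := Urad N p α ‖x‖

/-- The bifurcation values `α(k)`. -/
def alphaK (N p : ℝ) (k : ℕ) : ℝ :=
  (p * Real.sqrt ((N + p - 2) ^ 2 + 4 * ((k : ℝ) - 1) * (p - 1) * ((k : ℝ) + N - 1))
      - p * (N + p - 2)) / (2 * (p - 1))

/-- The divergence (trace) of an endomorphism of `ℝ^N`. -/
def divTrace {N : ℕ} (L : EuclideanSpace ℝ (Fin N) →L[ℝ] EuclideanSpace ℝ (Fin N)) : ℝ :=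
  ∑ i : Fin N, L (EuclideanSpace.single i 1) i

lemma divTrace_add {N : ℕ} (L M : EuclideanSpace ℝ (Fin N) →L[ℝ] EuclideanSpace ℝ (Fin N)) :
    divTrace (L + M) = divTrace L + divTrace M := by
  simp [divTrace, Finset.sum_add_distrib]

lemma divTrace_smul {N : ℕ} (c : ℝ)
    (L : EuclideanSpace ℝ (Fin N) →L[ℝ] EuclideanSpace ℝ (Fin N)) :
    divTrace (c • L) = c * divTrace L := by
  simp [divTrace, Finset.mul_sum]

lemma divTrace_id {N : ℕ} :
    divTrace (ContinuousLinearMap.id ℝ (EuclideanSpace ℝ (Fin N))) = N := by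
  simp [divTrace]

lemma divTrace_smulRight {N : ℕ} (l : EuclideanSpace ℝ (Fin N) →L[ℝ] ℝ)
    (V : EuclideanSpace ℝ (Fin N)) : divTrace (l.smulRight V) = l V := by
  have hV : V = ∑ i : Fin N, V i • EuclideanSpace.single i (1 : ℝ) := by
    ext j; simp [Finset.sum_apply, Pi.single_apply]
  conv_rhs => rw [hV, map_sum]
  simp [divTrace, mul_comm]

lemma integral_divTrace_eq_zero {N : ℕ} {G : EuclideanSpace ℝ (Fin N) → EuclideanSpace ℝ (Fin N)}
    (hG : ContDiff ℝ 1 G) (hc : HasCompactSupport G) :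
    ∫ x, divTrace (fderiv ℝ G x) = 0 := by
  have hcont : Continuous (fderiv ℝ G) := hG.continuous_fderiv one_ne_zero
  have hInt : ∀ i : Fin N, Integrable fun x => fderiv ℝ G x (EuclideanSpace.single i 1) := by
    intro i
    refine Continuous.integrable_of_hasCompactSupport (by fun_prop) ?_
    exact hc.fderiv_apply ℝ _
  have hzero : ∀ i : Fin N, ∫ x, fderiv ℝ G x (EuclideanSpace.single i 1) = 0 := by
    intro i
    have := integral_smul_fderiv_eq_neg_fderiv_smul_of_integrable (μ := volume)
      (f := fun _ : EuclideanSpace ℝ (Fin N) => (1 : ℝ)) (g := G)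
      (v := EuclideanSpace.single i 1) (by simp) (by simpa using hInt i)
      (by simpa using hG.continuous.integrable_of_hasCompactSupport hc)
      (fun x _ => by fun_prop) (fun x _ => hG.differentiable one_ne_zero x)
    simpa using this
  unfold divTrace
  have hproj : ∀ i : Fin N, (fun x => fderiv ℝ G x (EuclideanSpace.single i 1) i) =
      fun x => (EuclideanSpace.proj i : EuclideanSpace ℝ (Fin N) →L[ℝ] ℝ)
        (fderiv ℝ G x (EuclideanSpace.single i 1)) := fun i => rfl
  rw [integral_finsetSum]
  · refine Finset.sum_eq_zero fun i _ => ?_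
    rw [hproj, ContinuousLinearMap.integral_comp_comm _ (hInt i), hzero, map_zero]
  · intro i _
    rw [hproj]
    exact ContinuousLinearMap.integrable_comp _ (hInt i)

/-- Integration by parts for a field that is `C¹` away from the origin, against a test function
that vanishes near the origin. -/
lemma integral_divTrace_mul_add_fderiv_apply_eq_zero {N : ℕ}
    {F : EuclideanSpace ℝ (Fin N) → EuclideanSpace ℝ (Fin N)} (hF : ContDiffOn ℝ 1 F {0}ᶜ)
    {h : EuclideanSpace ℝ (Fin N) → ℝ} (hdiv : ∀ x ≠ 0, divTrace (fderiv ℝ F x) = h x)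
    {ψ : EuclideanSpace ℝ (Fin N) → ℝ} (hψ : ContDiff ℝ 1 ψ) (hc : HasCompactSupport ψ)
    (h0 : ∀ᶠ x in nhds 0, ψ x = 0) :
    ∫ x, (ψ x * h x + fderiv ℝ ψ x (F x)) = 0 := by
  have hG : ContDiff ℝ 1 (fun x => ψ x • F x) := by
    rw [contDiff_iff_contDiffAt]
    intro x
    by_cases hx : x = 0
    · subst hx
      refine (contDiffAt_const (c := (0 : EuclideanSpace ℝ (Fin N)))).congr_of_eventuallyEq ?_
      filter_upwards [h0] with y hy
      simp [hy]
    · exact hψ.contDiffAt.smul (hF.contDiffAt (isOpen_compl_singleton.mem_nhds hx))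
  rw [← integral_divTrace_eq_zero hG hc.smul_right]
  congr 1 with x
  by_cases hx : x = 0
  · subst hx
    have h1 : (fun x => ψ x • F x) =ᶠ[nhds 0] fun _ => 0 := by
      filter_upwards [h0] with y hy
      simp [hy]
    have h2 : ψ =ᶠ[nhds 0] fun _ => 0 := h0
    rw [h1.fderiv_eq, h2.fderiv_eq, h0.self_of_nhds]
    simp [divTrace]
  · have hFx : DifferentiableAt ℝ F x :=
      (hF.contDiffAt (isOpen_compl_singleton.mem_nhds hx)).differentiableAt one_ne_zero
    rw [fderiv_fun_smul (hψ.differentiable one_ne_zero x) hFx, divTrace_add, divTrace_smul,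
      divTrace_smulRight, hdiv x hx]

/-- If a locally bounded field `F` is `C¹` away from the origin of `ℝ^N`, `N ≥ 2`, with a
continuous divergence `h`, then `div F = h` weakly on all of `ℝ^N`. -/
lemma integral_fderiv_apply_eq_neg_of_punctured {N : ℕ} (hN : 2 ≤ N)
    {F : EuclideanSpace ℝ (Fin N) → EuclideanSpace ℝ (Fin N)} (hF : ContDiffOn ℝ 1 F {0}ᶜ)
    {B : EuclideanSpace ℝ (Fin N) → ℝ} (hB : Continuous B) (hFB : ∀ x ≠ 0, ‖F x‖ ≤ B x)
    {h : EuclideanSpace ℝ (Fin N) → ℝ} (hh : Continuous h)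
    (hdiv : ∀ x ≠ 0, divTrace (fderiv ℝ F x) = h x)
    {φ : EuclideanSpace ℝ (Fin N) → ℝ} (hφ : ContDiff ℝ 1 φ) (hc : HasCompactSupport φ) :
    Integrable (fun x => fderiv ℝ φ x (F x)) ∧
      ∫ x, fderiv ℝ φ x (F x) = - ∫ x, h x * φ x := by
  have : NeZero N := ⟨by omega⟩
  have : Nonempty (Fin N) := ⟨0⟩
  have hne : ∀ᵐ x : EuclideanSpace ℝ (Fin N), x ≠ 0 := by
    simp [ae_iff]
  have hFm : AEStronglyMeasurable F := by
    have := hF.continuousOn.aestronglyMeasurable (μ := volume)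
      (measurableSet_singleton (0 : EuclideanSpace ℝ (Fin N))).compl
    rwa [restrict_compl_singleton] at this
  have hφ' : Continuous (fderiv ℝ φ) := hφ.continuous_fderiv one_ne_zero
  have hφ'c : HasCompactSupport (fderiv ℝ φ) := hc.fderiv ℝ
  have happ : ∀ {L : EuclideanSpace ℝ (Fin N) → EuclideanSpace ℝ (Fin N) →L[ℝ] ℝ},
      Continuous L → AEStronglyMeasurable (fun x => L x (F x)) := fun hL =>
    isBoundedBilinearMap_apply.continuous.comp_aestronglyMeasurable
      (hL.aestronglyMeasurable.prodMk hFm)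
  have hInt1 : Integrable (fun x => fderiv ℝ φ x (F x)) := by
    have hdom : Integrable (fun x => ‖fderiv ℝ φ x‖ * B x) :=
      Continuous.integrable_of_hasCompactSupport (by fun_prop) (hφ'c.norm.mul_right)
    refine hdom.mono' (happ hφ') ?_
    filter_upwards [hne] with x hx
    exact ((fderiv ℝ φ x).le_opNorm _).trans
      (mul_le_mul_of_nonneg_left (hFB x hx) (norm_nonneg _))
  have hInt2 : Integrable (fun x => φ x * h x) :=
    Continuous.integrable_of_hasCompactSupport (hφ.continuous.mul hh) hc.mul_right
  refine ⟨hInt1, ?_⟩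
  let g : ContDiffBump (0 : EuclideanSpace ℝ (Fin N)) := ⟨1, 2, by norm_num, by norm_num⟩
  have hg : ContDiff ℝ 1 g := g.contDiff
  have hgc : HasCompactSupport g := g.hasCompactSupport
  let η : ℕ → EuclideanSpace ℝ (Fin N) → ℝ := fun n x => 1 - g (((n : ℝ) + 1) • x)
  have hη : ∀ n, ContDiff ℝ 1 (η n) := fun n =>
    contDiff_const.sub (hg.comp (contDiff_const_smul _))
  have hη1 : ∀ n x, ‖η n x‖ ≤ 1 := by
    intro n x
    have h1 := g.nonneg (x := ((n : ℝ) + 1) • x)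
    have h2 := g.le_one (x := ((n : ℝ) + 1) • x)
    rw [Real.norm_eq_abs, abs_le]
    constructor <;> simp only [η] <;> linarith
  have hη' : ∀ n x, fderiv ℝ (η n) x = -(((n : ℝ) + 1) • fderiv ℝ g (((n : ℝ) + 1) • x)) := by
    intro n x
    have hgd : DifferentiableAt ℝ g (((n : ℝ) + 1) • x) := hg.differentiable one_ne_zero _
    simp only [η]
    rw [fderiv_const_sub, fderiv_comp_smul]
  have hη0 : ∀ n, ∀ᶠ x in nhds 0, η n x = 0 := by
    intro n
    have hcont : Filter.Tendsto (fun x : EuclideanSpace ℝ (Fin N) => ((n : ℝ) + 1) • x)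
        (nhds 0) (nhds 0) := by
      have : Continuous fun x : EuclideanSpace ℝ (Fin N) => ((n : ℝ) + 1) • x := by fun_prop
      simpa using this.tendsto 0
    filter_upwards [hcont.eventually g.eventuallyEq_one] with x hx
    simp only [η]
    rw [hx]; simp
  have key : ∀ n, ∫ x, η n x * (φ x * h x + fderiv ℝ φ x (F x)) =
      - ∫ x, φ x * fderiv ℝ (η n) x (F x) := by
    intro n
    have hφd := hφ.differentiable one_ne_zero
    have hηd := (hη n).differentiable one_ne_zero
    have hη'c : Continuous (fderiv ℝ (η n)) := (hη n).continuous_fderiv one_ne_zero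
    have hI : Integrable (fun x => φ x * fderiv ℝ (η n) x (F x)) := by
      have hdom : Integrable (fun x => ‖φ x‖ * (‖fderiv ℝ (η n) x‖ * B x)) :=
        Continuous.integrable_of_hasCompactSupport
          (hφ.continuous.norm.mul (hη'c.norm.mul hB)) (hc.norm.mul_right)
      refine hdom.mono' (hφ.continuous.aestronglyMeasurable.mul (happ hη'c)) ?_
      filter_upwards [hne] with x hx
      rw [norm_mul]
      exact mul_le_mul_of_nonneg_left (((fderiv ℝ (η n) x).le_opNorm _).trans
        (mul_le_mul_of_nonneg_left (hFB x hx) (norm_nonneg _))) (norm_nonneg _)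
    have hI' : Integrable (fun x => η n x * (φ x * h x + fderiv ℝ φ x (F x))) :=
      (hInt2.add hInt1).bdd_mul (hη n).continuous.aestronglyMeasurable
        (Filter.Eventually.of_forall (hη1 n))
    have h0 := integral_divTrace_mul_add_fderiv_apply_eq_zero hF hdiv ((hη n).mul hφ)
      hc.mul_left (by filter_upwards [hη0 n] with x hx; simp [hx])
    rw [eq_neg_iff_add_eq_zero, ← integral_add hI' hI, ← h0]
    congr 1 with x
    rw [fderiv_fun_mul (hηd x) (hφd x)]
    simp
    ring
  have hlim1 : Filter.Tendsto (fun n => ∫ x, η n x * (φ x * h x + fderiv ℝ φ x (F x)))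
      Filter.atTop (nhds (∫ x, (φ x * h x + fderiv ℝ φ x (F x)))) := by
    refine tendsto_integral_of_dominated_convergence
      (fun x => ‖φ x * h x + fderiv ℝ φ x (F x)‖) ?_ (hInt2.add hInt1).norm ?_ ?_
    · exact fun n => (hη n).continuous.aestronglyMeasurable.mul
        (hInt2.add hInt1).aestronglyMeasurable
    · refine fun n => Filter.Eventually.of_forall fun x => ?_
      rw [norm_mul]
      exact mul_le_of_le_one_left (norm_nonneg _) (hη1 n x)
    · filter_upwards [hne] with x hx
      refine tendsto_const_nhds.congr' ?_
      filter_upwards [Filter.eventually_ge_atTop ⌈2 / ‖x‖⌉₊] with n hn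
      have hx' : 0 < ‖x‖ := norm_pos_iff.2 hx
      have h2 : 2 ≤ ((n : ℝ) + 1) * ‖x‖ := by
        have := Nat.ceil_le.1 hn
        rw [div_le_iff₀ hx'] at this
        nlinarith
      have : g (((n : ℝ) + 1) • x) = 0 := by
        apply g.zero_of_le_dist
        simpa [dist_eq_norm, norm_smul, abs_of_nonneg (by positivity : (0 : ℝ) ≤ n + 1)] using h2
      simp [η, this]
  have hlim2 : Filter.Tendsto (fun n => ∫ x, φ x * fderiv ℝ (η n) x (F x))
      Filter.atTop (nhds 0) := by
    obtain ⟨Mφ, hMφ⟩ := hc.exists_bound_of_continuous hφ.continuous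
    obtain ⟨Mg, hMg⟩ := (hgc.fderiv ℝ).exists_bound_of_continuous
      (hg.continuous_fderiv one_ne_zero)
    obtain ⟨MB, hMB⟩ := (isCompact_closedBall (0 : EuclideanSpace ℝ (Fin N)) 2
      ).exists_bound_of_continuousOn hB.continuousOn
    have hMφ0 : 0 ≤ Mφ := (norm_nonneg _).trans (hMφ 0)
    have hMg0 : 0 ≤ Mg := (norm_nonneg _).trans (hMg 0)
    have hMB0 : 0 ≤ MB := (norm_nonneg _).trans (hMB 0 (by simp))
    set V : ℝ := volume.real (Metric.ball (0 : EuclideanSpace ℝ (Fin N)) 1)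
    have hV : 0 ≤ V := measureReal_nonneg
    set K : ℝ := Mφ * (Mg * MB) * (4 * 2 ^ (N - 2)) * V
    have hK : Filter.Tendsto (fun n : ℕ => K * (1 / ((n : ℝ) + 1))) Filter.atTop (nhds 0) := by
      simpa using tendsto_one_div_add_atTop_nhds_zero_nat.const_mul K
    refine squeeze_zero_norm (fun n => ?_) hK
    have hn : (0 : ℝ) < n + 1 := by positivity
    have hzero : ∀ x, x ∉ Metric.closedBall (0 : EuclideanSpace ℝ (Fin N)) (2 / ((n : ℝ) + 1)) →
        φ x * fderiv ℝ (η n) x (F x) = 0 := by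
      intro x hx
      have : fderiv ℝ g (((n : ℝ) + 1) • x) = 0 := by
        apply fderiv_of_notMem_tsupport
        rw [g.tsupport_eq]
        simp only [Metric.mem_closedBall, dist_zero_right, not_le] at hx ⊢
        rw [div_lt_iff₀ hn] at hx
        rw [norm_smul, Real.norm_eq_abs, abs_of_pos hn, mul_comm]
        exact hx
      rw [hη', this]
      simp
    rw [← setIntegral_eq_integral_of_forall_compl_eq_zero hzero]
    have hbd : ∀ᵐ x ∂volume.restrict
        (Metric.closedBall (0 : EuclideanSpace ℝ (Fin N)) (2 / ((n : ℝ) + 1))),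
        ‖φ x * fderiv ℝ (η n) x (F x)‖ ≤ Mφ * (((n : ℝ) + 1) * Mg * MB) := by
      filter_upwards [ae_restrict_mem measurableSet_closedBall, ae_restrict_of_ae hne] with x hx hx0
      have hx2 : x ∈ Metric.closedBall (0 : EuclideanSpace ℝ (Fin N)) 2 :=
        Metric.closedBall_subset_closedBall
          (div_le_self (by norm_num) (by linarith [Nat.cast_nonneg (α := ℝ) n])) hx
      rw [norm_mul]
      refine mul_le_mul (hMφ x) (((fderiv ℝ (η n) x).le_opNorm _).trans ?_) (norm_nonneg _) hMφ0
      refine mul_le_mul ?_ ((hFB x hx0).trans ((le_abs_self _).trans (hMB x hx2)))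
        (norm_nonneg _) (by positivity)
      rw [hη', norm_neg, norm_smul, Real.norm_eq_abs, abs_of_pos hn]
      exact mul_le_mul_of_nonneg_left (hMg _) hn.le
    refine (norm_setIntegral_le_of_norm_le_const_ae measure_closedBall_lt_top hbd).trans ?_
    rw [Measure.addHaar_real_closedBall _ _ (by positivity), finrank_euclideanSpace,
      Fintype.card_fin]
    have hpow : (2 / ((n : ℝ) + 1)) ^ N ≤ 4 * 2 ^ (N - 2) / ((n : ℝ) + 1) ^ 2 := by
      have h1 : 2 / ((n : ℝ) + 1) ≤ 2 :=
        div_le_self (by norm_num) (by linarith [Nat.cast_nonneg (α := ℝ) n])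
      calc (2 / ((n : ℝ) + 1)) ^ N = (2 / ((n : ℝ) + 1)) ^ 2 * (2 / ((n : ℝ) + 1)) ^ (N - 2) := by
            rw [← pow_add]; congr 1; omega
        _ ≤ (2 / ((n : ℝ) + 1)) ^ 2 * 2 ^ (N - 2) := by gcongr
        _ = 4 * 2 ^ (N - 2) / ((n : ℝ) + 1) ^ 2 := by rw [div_pow]; ring
    calc Mφ * (((n : ℝ) + 1) * Mg * MB) * ((2 / ((n : ℝ) + 1)) ^ N * V)
        ≤ Mφ * (((n : ℝ) + 1) * Mg * MB) * (4 * 2 ^ (N - 2) / ((n : ℝ) + 1) ^ 2 * V) := by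
          gcongr
      _ = K * (1 / ((n : ℝ) + 1)) := by
          simp only [K]; field_simp
  have hsum : ∫ x, (φ x * h x + fderiv ℝ φ x (F x)) = 0 := by
    refine tendsto_nhds_unique hlim1 ?_
    simp_rw [key]
    simpa using hlim2.neg
  rw [integral_add hInt2 hInt1] at hsum
  have : ∫ x, h x * φ x = ∫ x, φ x * h x := by simp_rw [mul_comm]
  linarith

lemma contDiff_mvPolynomial_eval {N : ℕ} {n : WithTop ℕ∞} (P : MvPolynomial (Fin N) ℝ) :
    ContDiff ℝ n fun x : EuclideanSpace ℝ (Fin N) => MvPolynomial.eval (fun i => x i) P := by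
  induction P using MvPolynomial.induction_on with
  | C a => simpa using contDiff_const
  | add P Q hP hQ => simpa using hP.add hQ
  | mul_X P i hP =>
    have hi : ContDiff ℝ n fun x : EuclideanSpace ℝ (Fin N) => x i :=
      (EuclideanSpace.proj i : EuclideanSpace ℝ (Fin N) →L[ℝ] ℝ).contDiff
    simpa using hP.mul hi

section Homogeneous

variable {E : Type*} [NormedAddCommGroup E] [InnerProductSpace ℝ E]

lemma fderiv_apply_self_of_homogeneous {Φ : E → ℝ} {k : ℕ}
    (hhom : ∀ (c : ℝ) (x : E), Φ (c • x) = c ^ k * Φ x) {x : E} (hd : DifferentiableAt ℝ Φ x) :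
    fderiv ℝ Φ x x = k * Φ x := by
  have h1 : HasDerivAt (fun c : ℝ => Φ (c • x)) (fderiv ℝ Φ x x) 1 := by
    have h2 : HasDerivAt (fun c : ℝ => c • x) x 1 := by
      simpa using (hasDerivAt_id (1 : ℝ)).smul_const x
    have h3 : HasFDerivAt Φ (fderiv ℝ Φ x) ((1 : ℝ) • x) := by simpa using hd.hasFDerivAt
    exact h3.comp_hasDerivAt 1 h2
  have h4 : HasDerivAt (fun c : ℝ => Φ (c • x)) (k * Φ x) 1 := by
    simp_rw [hhom]
    simpa using (hasDerivAt_pow k (1 : ℝ)).mul_const (Φ x)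
  exact h1.unique h4

lemma fderiv_smul_of_homogeneous {Φ : E → ℝ} {k : ℕ} (hk : 1 ≤ k)
    (hhom : ∀ (c : ℝ) (x : E), Φ (c • x) = c ^ k * Φ x) (hd : Differentiable ℝ Φ)
    {c : ℝ} (hc : c ≠ 0) (x : E) : fderiv ℝ Φ (c • x) = c ^ (k - 1) • fderiv ℝ Φ x := by
  have h1 : c • fderiv ℝ Φ (c • x) = c ^ k • fderiv ℝ Φ x := by
    rw [← fderiv_comp_smul]
    simp_rw [hhom]
    rw [fderiv_const_mul (hd x)]
  have h2 : c • fderiv ℝ Φ (c • x) = c • (c ^ (k - 1) • fderiv ℝ Φ x) := by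
    rw [h1, smul_smul, ← pow_succ', Nat.sub_add_cancel hk]
  exact smul_right_injective _ hc h2

lemma exists_bound_of_homogeneous [FiniteDimensional ℝ E] {Φ : E → ℝ} {k : ℕ} (hk : 1 ≤ k)
    (hhom : ∀ (c : ℝ) (x : E), Φ (c • x) = c ^ k * Φ x) (hΦ : ContDiff ℝ 1 Φ) :
    ∃ M : ℝ, 0 ≤ M ∧ ∀ x : E, x ≠ 0 →
      |Φ x| ≤ M * ‖x‖ ^ k ∧ ‖fderiv ℝ Φ x‖ ≤ M * ‖x‖ ^ (k - 1) := by
  obtain ⟨M₁, h₁⟩ := (isCompact_closedBall (0 : E) 1).exists_bound_of_continuousOn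
    hΦ.continuous.continuousOn
  obtain ⟨M₂, h₂⟩ := (isCompact_closedBall (0 : E) 1).exists_bound_of_continuousOn
    (hΦ.continuous_fderiv one_ne_zero).continuousOn
  have hM₁ : 0 ≤ M₁ := (norm_nonneg _).trans (h₁ 0 (by simp))
  refine ⟨max M₁ M₂, hM₁.trans (le_max_left _ _), fun x hx => ?_⟩
  have hr : 0 < ‖x‖ := norm_pos_iff.2 hx
  set θ : E := ‖x‖⁻¹ • x
  have hθ : θ ∈ Metric.closedBall (0 : E) 1 := by
    simp [θ, norm_smul, inv_mul_cancel₀ hr.ne']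
  have hxθ : x = ‖x‖ • θ := by simp [θ, smul_smul, mul_inv_cancel₀ hr.ne']
  constructor
  · conv_lhs => rw [hxθ, hhom, abs_mul, abs_of_nonneg (by positivity), mul_comm]
    exact mul_le_mul_of_nonneg_right ((h₁ θ hθ).trans (le_max_left _ _)) (by positivity)
  · conv_lhs => rw [hxθ, fderiv_smul_of_homogeneous hk hhom (hΦ.differentiable one_ne_zero) hr.ne',
      norm_smul, Real.norm_of_nonneg (by positivity), mul_comm]
    exact mul_le_mul_of_nonneg_right ((h₂ θ hθ).trans (le_max_right _ _)) (by positivity)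

lemma hasFDerivAt_comp_norm {g : ℝ → ℝ} {g' : ℝ} {x : E} (hx : x ≠ 0)
    (hg : HasDerivAt g g' ‖x‖) :
    HasFDerivAt (fun y : E => g ‖y‖) ((g' / ‖x‖) • innerSL ℝ x) x := by
  have hn : HasFDerivAt (fun y : E => ‖y‖) (‖x‖⁻¹ • innerSL ℝ x) x := by
    have h1 : HasFDerivAt (fun y : E => √(‖y‖ ^ 2)) ((1 / (2 * √(‖x‖ ^ 2))) • (2 • innerSL ℝ x)) x :=
      (hasStrictFDerivAt_norm_sq x).hasFDerivAt.sqrt (by simpa using hx)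
    simp only [Real.sqrt_sq (norm_nonneg _)] at h1
    convert h1 using 1
    ext y
    simp
    ring
  have h2 := hg.comp_hasFDerivAt x hn
  rw [smul_smul, ← div_eq_mul_inv] at h2
  exact h2

lemma gradient_comp_norm [CompleteSpace E] {g : ℝ → ℝ} {g' : ℝ} {x : E} (hx : x ≠ 0)
    (hg : HasDerivAt g g' ‖x‖) : gradient (fun y : E => g ‖y‖) x = (g' / ‖x‖) • x := by
  refine ext_inner_right ℝ fun y => ?_
  rw [inner_gradient_left, (hasFDerivAt_comp_norm hx hg).fderiv]
  simp [inner_smul_left]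

lemma gradient_comp_norm_mul [CompleteSpace E] {g : ℝ → ℝ} {g' : ℝ} {Φ : E → ℝ} {x : E}
    (hx : x ≠ 0) (hg : HasDerivAt g g' ‖x‖) (hΦ : DifferentiableAt ℝ Φ x) :
    gradient (fun y : E => g ‖y‖ * Φ y) x =
      g ‖x‖ • gradient Φ x + (g' / ‖x‖ * Φ x) • x := by
  refine ext_inner_right ℝ fun y => ?_
  rw [inner_gradient_left, ((hasFDerivAt_comp_norm hx hg).fun_mul hΦ.hasFDerivAt).fderiv]
  simp [inner_add_left, inner_smul_left, inner_gradient_left]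
  ring

end Homogeneous

lemma contDiff_gradient {E : Type*} [NormedAddCommGroup E] [InnerProductSpace ℝ E]
    [CompleteSpace E] {Φ : E → ℝ} (hΦ : ContDiff ℝ 2 Φ) : ContDiff ℝ 1 (gradient Φ) := by
  have h1 : ContDiff ℝ 1 (fderiv ℝ Φ) := hΦ.fderiv_right (by norm_num)
  exact (InnerProductSpace.toDual ℝ E).symm.contDiff.comp h1

lemma divTrace_fderiv_gradient {N : ℕ} {Φ : EuclideanSpace ℝ (Fin N) → ℝ} (hΦ : ContDiff ℝ 2 Φ)
    (x : EuclideanSpace ℝ (Fin N)) :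
    divTrace (fderiv ℝ (gradient Φ) x) =
      ∑ i : Fin N, fderiv ℝ (fun y => fderiv ℝ Φ y (EuclideanSpace.single i 1)) x
        (EuclideanSpace.single i 1) := by
  unfold divTrace
  refine Finset.sum_congr rfl fun i _ => ?_
  have h1 : (fun y => fderiv ℝ Φ y (EuclideanSpace.single i 1)) =
      (EuclideanSpace.proj i : EuclideanSpace ℝ (Fin N) →L[ℝ] ℝ) ∘ gradient Φ := by
    ext y
    rw [← inner_gradient_left, EuclideanSpace.inner_single_right]
    simp
  rw [h1, ((EuclideanSpace.proj i : EuclideanSpace ℝ (Fin N) →L[ℝ] ℝ).hasFDerivAt.comp x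
    ((contDiff_gradient hΦ).differentiable one_ne_zero x).hasFDerivAt).fderiv]
  rfl

lemma divTrace_fderiv_radial_field {N k : ℕ} {Φ : EuclideanSpace ℝ (Fin N) → ℝ}
    (hΦ : ContDiff ℝ 2 Φ)
    (hhom : ∀ (c : ℝ) (x : EuclideanSpace ℝ (Fin N)), Φ (c • x) = c ^ k * Φ x)
    (hharm : ∀ x : EuclideanSpace ℝ (Fin N),
      ∑ i : Fin N, fderiv ℝ (fun y => fderiv ℝ Φ y (EuclideanSpace.single i 1)) x
        (EuclideanSpace.single i 1) = 0)
    {a b : ℝ → ℝ} {a' b' : ℝ} {x : EuclideanSpace ℝ (Fin N)} (hx : x ≠ 0)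
    (ha : HasDerivAt a a' ‖x‖) (hb : HasDerivAt b b' ‖x‖) :
    divTrace (fderiv ℝ (fun y => a ‖y‖ • gradient Φ y + (b ‖y‖ * Φ y) • y) x) =
      (k * a' / ‖x‖ + b' * ‖x‖ + (k + N) * b ‖x‖) * Φ x := by
  have hr : ‖x‖ ≠ 0 := norm_ne_zero_iff.2 hx
  have hΦd : DifferentiableAt ℝ Φ x := hΦ.differentiable two_ne_zero x
  have h1 := (hasFDerivAt_comp_norm hx ha).fun_smul
    ((contDiff_gradient hΦ).differentiable one_ne_zero x).hasFDerivAt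
  have h2 := ((hasFDerivAt_comp_norm hx hb).fun_mul hΦd.hasFDerivAt).fun_smul 
    (hasFDerivAt_id x)
  have h3 := h1.fun_add h2
  have hE := fderiv_apply_self_of_homogeneous hhom hΦd
  have h4 : HasFDerivAt (fun y => a ‖y‖ • gradient Φ y + (b ‖y‖ * Φ y) • y) _ x := h3
  rw [h4.fderiv]
  simp only [divTrace_add, divTrace_smul, divTrace_smulRight, divTrace_fderiv_gradient hΦ, hharm,
    divTrace_id]
  have hin : inner ℝ x (gradient Φ x) = k * Φ x := by
    rw [real_inner_comm, inner_gradient_left, hE]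
  simp [hin, hE]
  field_simp
  ring

section Profiles

lemma hasDerivAt_profile (c x q z : ℝ) {r : ℝ} (hr : 0 < r) :
    HasDerivAt (fun r : ℝ => c * r ^ x * (1 + r ^ q) ^ z)
      (c * r ^ x * (1 + r ^ q) ^ z / r * (x + z * q * (r ^ q / (1 + r ^ q)))) r := by
  have hq : 0 < r ^ q := rpow_pos_of_pos hr q
  have hm : 0 < 1 + r ^ q := by positivity
  have h1 := (hasDerivAt_rpow_const (p := x) (Or.inl hr.ne')).const_mul c
  have h2 := ((hasDerivAt_rpow_const (p := q) (Or.inl hr.ne')).const_add 1).rpow_const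
    (p := z) (Or.inl hm.ne')
  refine (h1.mul h2).congr_deriv ?_
  rw [rpow_sub_one hr.ne', rpow_sub_one hr.ne', rpow_sub_one hm.ne']
  field_simp

lemma hasDerivAt_ratio (q : ℝ) {r : ℝ} (hr : 0 < r) :
    HasDerivAt (fun r : ℝ => r ^ q / (1 + r ^ q))
      (q * (r ^ q / (1 + r ^ q)) * (1 - r ^ q / (1 + r ^ q)) / r) r := by
  have hq : 0 < r ^ q := rpow_pos_of_pos hr q
  have hm : 0 < 1 + r ^ q := by positivity
  have h1 := hasDerivAt_rpow_const (p := q) (Or.inl hr.ne')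
  refine (h1.div (h1.const_add 1) hm.ne').congr_deriv ?_
  rw [rpow_sub_one hr.ne']
  field_simp

lemma contDiffAt_profile {n : WithTop ℕ∞} (c x q z : ℝ) {r : ℝ} (hr : 0 < r) :
    ContDiffAt ℝ n (fun r : ℝ => c * r ^ x * (1 + r ^ q) ^ z) r := by
  have hm : 0 < 1 + r ^ q := add_pos one_pos (rpow_pos_of_pos hr q)
  exact (contDiffAt_const.mul (contDiffAt_id.rpow_const_of_ne hr.ne')).mul
    ((contDiffAt_const.add (contDiffAt_id.rpow_const_of_ne hr.ne')).rpow_const_of_ne hm.ne')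

lemma contDiffAt_ratio {n : WithTop ℕ∞} (q : ℝ) {r : ℝ} (hr : 0 < r) :
    ContDiffAt ℝ n (fun r : ℝ => r ^ q / (1 + r ^ q)) r := by
  have hm : 0 < 1 + r ^ q := add_pos one_pos (rpow_pos_of_pos hr q)
  exact (contDiffAt_id.rpow_const_of_ne hr.ne').div
    (contDiffAt_const.add (contDiffAt_id.rpow_const_of_ne hr.ne')) hm.ne'

end Profiles

lemma alphaK_nonneg {N p : ℝ} (hN : 2 ≤ N) (hp : 1 < p) {k : ℕ} (hk : 1 ≤ k) :
    0 ≤ alphaK N p k := by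
  have hk' : (1 : ℝ) ≤ k := by exact_mod_cast hk
  have h1 : N + p - 2 ≤
      √((N + p - 2) ^ 2 + 4 * ((k : ℝ) - 1) * (p - 1) * ((k : ℝ) + N - 1)) := by
    apply Real.le_sqrt_of_sq_le
    have : 0 ≤ 4 * ((k : ℝ) - 1) * (p - 1) * ((k : ℝ) + N - 1) :=
      mul_nonneg (mul_nonneg (by linarith) (by linarith)) (by linarith)
    linarith
  unfold alphaK
  apply div_nonneg _ (by linarith)
  rw [← mul_sub]
  exact mul_nonneg (by linarith) (by linarith)

/-- The quadratic equation satisfied by `α(k) / p`. -/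
lemma alphaK_quadratic {N p : ℝ} (hN : 2 ≤ N) (hp : 1 < p) {k : ℕ} (hk : 1 ≤ k) :
    (p - 1) * (alphaK N p k / p) ^ 2 + (N + p - 2) * (alphaK N p k / p) =
      ((k : ℝ) - 1) * (k + N - 1) := by
  have hk' : (1 : ℝ) ≤ k := by exact_mod_cast hk
  have hp1 : p - 1 ≠ 0 := by linarith
  have hp0 : p ≠ 0 := by linarith
  have h0 : 0 ≤ (N + p - 2) ^ 2 + 4 * ((k : ℝ) - 1) * (p - 1) * ((k : ℝ) + N - 1) := by
    have : 0 ≤ 4 * ((k : ℝ) - 1) * (p - 1) * ((k : ℝ) + N - 1) :=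
      mul_nonneg (mul_nonneg (by linarith) (by linarith)) (by linarith)
    positivity
  have hs := Real.sq_sqrt h0
  unfold alphaK
  set S := √((N + p - 2) ^ 2 + 4 * ((k : ℝ) - 1) * (p - 1) * ((k : ℝ) + N - 1))
  have h1 : (p * S - p * (N + p - 2)) / (2 * (p - 1)) / p = (S - (N + p - 2)) / (2 * (p - 1)) := by
    field_simp
  rw [h1]
  field_simp
  linear_combination hs

lemma Cnpa_pos {N p α : ℝ} (hp : 1 < p) (hpN : p < N) (hα : 0 ≤ α) : 0 < Cnpa N p α := by
  have h1 : 0 < (N - p) / (p - 1) := div_pos (by linarith) (by linarith)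
  have h2 : 0 < N + α := by linarith
  unfold Cnpa
  positivity

/-- The constant factor of `gradProfile`. -/
def gradConst (N p α : ℝ) : ℝ := Cnpa N p α * ((N - p) / (p - 1))

/-- Minus the derivative of the radial profile `Urad`. -/
def gradProfile (N p α r : ℝ) : ℝ :=
  gradConst N p α * r ^ ((p + α) / (p - 1) - 1) *
    (1 + r ^ ((p + α) / (p - 1))) ^ (-((N + α) / (p + α)))

/-- The radial factor of `v` multiplying the solid harmonic of degree `k`. -/
def solProfile (N p α k r : ℝ) : ℝ :=
  1 * r ^ ((p + α) / (p * (p - 1)) - k) *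
    (1 + r ^ ((p + α) / (p - 1))) ^ (-((N + α) / (p + α)))

/-- The logarithmic derivative of `solProfile`, multiplied by `r`. -/
def solLogDeriv (N p α k r : ℝ) : ℝ :=
  (p + α) / (p * (p - 1)) - k + -((N + α) / (p + α)) * ((p + α) / (p - 1)) *
    (r ^ ((p + α) / (p - 1)) / (1 + r ^ ((p + α) / (p - 1))))

/-- The radial coefficient of `∇Φ` in the linearized flux. -/
def fluxGrad (N p α k r : ℝ) : ℝ :=
  gradConst N p α ^ (p - 2) * r ^ (α * (p - 1) / p + 1 - k) *
    (1 + r ^ ((p + α) / (p - 1))) ^ (-((N + α) / (p + α) * (p - 1)))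

/-- The radial coefficient of `Φ(x) x` in the linearized flux. -/
def fluxRad (N p α k r : ℝ) : ℝ :=
  (gradConst N p α ^ (p - 2) * r ^ (α * (p - 1) / p + 1 - k - 2) *
    (1 + r ^ ((p + α) / (p - 1))) ^ (-((N + α) / (p + α) * (p - 1)))) *
    (1 + α / p - k - (N + α) * (r ^ ((p + α) / (p - 1)) / (1 + r ^ ((p + α) / (p - 1)))))

lemma hasDerivAt_solProfile (N p α k : ℝ) {r : ℝ} (hr : 0 < r) :
    HasDerivAt (solProfile N p α k)
      (solProfile N p α k r / r * solLogDeriv N p α k r) r :=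
  hasDerivAt_profile 1 _ _ _ hr

section Scalar

variable {N p α : ℝ} (hp : 1 < p) (hpN : p < N) (hα : 0 ≤ α)

include hp hpN hα

lemma gradConst_pos : 0 < gradConst N p α :=
  mul_pos (Cnpa_pos hp hpN hα) (div_pos (by linarith) (by linarith))

lemma gradProfile_pos {r : ℝ} (hr : 0 < r) : 0 < gradProfile N p α r := by
  have := gradConst_pos hp hpN hα
  have : 0 < r ^ ((p + α) / (p - 1)) := rpow_pos_of_pos hr _
  unfold gradProfile
  positivity

lemma Urad_pos {r : ℝ} (hr : 0 ≤ r) : 0 < Urad N p α r := by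
  have := Cnpa_pos hp hpN hα
  have : 0 ≤ r ^ ((p + α) / (p - 1)) := rpow_nonneg hr _
  unfold Urad
  positivity

omit hpN in
lemma hasDerivAt_Urad {r : ℝ} (hr : 0 < r) :
    HasDerivAt (Urad N p α) (-gradProfile N p α r) r := by
  have h1 := hasDerivAt_profile (Cnpa N p α) 0 ((p + α) / (p - 1)) (-((N - p) / (p + α))) hr
  simp only [rpow_zero, mul_one] at h1
  refine h1.congr_deriv ?_
  have hq : 0 < r ^ ((p + α) / (p - 1)) := rpow_pos_of_pos hr _
  have hm : 0 < 1 + r ^ ((p + α) / (p - 1)) := by positivity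
  have hp1 : p - 1 ≠ 0 := by linarith
  have hpα : p + α ≠ 0 := by linarith
  have he : -((N + α) / (p + α)) = -((N - p) / (p + α)) - 1 := by field_simp; ring
  unfold gradProfile gradConst
  rw [he, rpow_sub_one hr.ne', rpow_sub_one hm.ne']
  field_simp
  ring

lemma gradProfile_rpow_mul_solProfile (k : ℝ) {r : ℝ} (hr : 0 < r) :
    gradProfile N p α r ^ (p - 2) * solProfile N p α k r = fluxGrad N p α k r := by
  have hD := gradConst_pos hp hpN hα
  have hq : 0 < r ^ ((p + α) / (p - 1)) := rpow_pos_of_pos hr _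
  have hm : 0 < 1 + r ^ ((p + α) / (p - 1)) := by positivity
  have hp1 : p - 1 ≠ 0 := by linarith
  have hpα : p + α ≠ 0 := by linarith
  unfold gradProfile solProfile fluxGrad
  rw [mul_rpow (by positivity) (by positivity), mul_rpow (by positivity) (by positivity),
    ← rpow_mul hr.le, ← rpow_mul hm.le]
  have e1 : α * (p - 1) / p + 1 - k =
      ((p + α) / (p - 1) - 1) * (p - 2) + ((p + α) / (p * (p - 1)) - k) := by
    field_simp; ring
  have e2 : -((N + α) / (p + α) * (p - 1)) =
      -((N + α) / (p + α)) * (p - 2) + -((N + α) / (p + α)) := by ring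
  rw [e1, e2, rpow_add hr, rpow_add hm]
  ring

omit hpN in
lemma fluxRad_eq (k : ℝ) {r : ℝ} (hr : 0 < r) :
    fluxRad N p α k r = fluxGrad N p α k r / r ^ 2 *
      ((p - 1) * solLogDeriv N p α k r + (p - 2) * k) := by
  have hp1 : p - 1 ≠ 0 := by linarith
  have hpα : p + α ≠ 0 := by linarith
  have hp0 : p ≠ 0 := by linarith
  unfold fluxRad fluxGrad solLogDeriv
  rw [rpow_sub hr _ 2, rpow_two]
  generalize r ^ ((p + α) / (p - 1)) / (1 + r ^ ((p + α) / (p - 1))) = t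
  have : (p - 1) * ((p + α) / (p * (p - 1)) - k +
      -((N + α) / (p + α)) * ((p + α) / (p - 1)) * t) + (p - 2) * k =
      1 + α / p - k - (N + α) * t := by
    field_simp; ring
  rw [this]
  ring

lemma const_identity :
    (pS N p α - 1) * Cnpa N p α ^ (pS N p α - 2) =
      gradConst N p α ^ (p - 2) * ((N + α) * (N * p + p * α - N + p) / (p - 1)) := by
  have hC := Cnpa_pos hp hpN hα
  have hl : 0 < (N - p) / (p - 1) := div_pos (by linarith) (by linarith)
  have hp1 : p - 1 ≠ 0 := by linarith
  have hpα : p + α ≠ 0 := by linarith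
  have hp0 : p ≠ 0 := by linarith
  have hNp : N - p ≠ 0 := by linarith
  have hNα : 0 < N + α := by linarith
  have h1 : Cnpa N p α ^ (pS N p α - p) = (N + α) * ((N - p) / (p - 1)) ^ (p - 1) := by
    unfold Cnpa
    rw [← rpow_mul (by positivity)]
    have : (N - p) / (p * (p + α)) * (pS N p α - p) = 1 := by
      unfold pS; field_simp; ring
    rw [this, rpow_one]
  have h2 : pS N p α - 2 = (pS N p α - p) + (p - 2) := by ring
  have h3 : ((N - p) / (p - 1)) ^ (p - 1) =
      ((N - p) / (p - 1)) ^ (p - 2) * ((N - p) / (p - 1)) := by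
    rw [← rpow_add_one hl.ne']; congr 1; ring
  rw [h2, rpow_add hC, h1, gradConst, mul_rpow hC.le hl.le, h3]
  unfold pS
  field_simp
  ring

lemma source_eq (k : ℝ) {r : ℝ} (hr : 0 < r) :
    (pS N p α - 1) * (r ^ α * Urad N p α r ^ (pS N p α - 2) * solProfile N p α k r) =
      (N + α) * (N * p + p * α - N + p) / (p - 1) *
        (r ^ ((p + α) / (p - 1)) / (1 + r ^ ((p + α) / (p - 1))) *
          (1 - r ^ ((p + α) / (p - 1)) / (1 + r ^ ((p + α) / (p - 1))))) *
        (fluxGrad N p α k r / r ^ 2) := by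
  have hC := Cnpa_pos hp hpN hα
  have hp1 : p - 1 ≠ 0 := by linarith
  have hpα : p + α ≠ 0 := by linarith
  have hp0 : p ≠ 0 := by linarith
  have hNp : N - p ≠ 0 := by linarith
  have hq : 0 < r ^ ((p + α) / (p - 1)) := rpow_pos_of_pos hr _
  have hm : 0 < 1 + r ^ ((p + α) / (p - 1)) := by positivity
  have h1 : r ^ ((p + α) / (p - 1)) / (1 + r ^ ((p + α) / (p - 1))) *
      (1 - r ^ ((p + α) / (p - 1)) / (1 + r ^ ((p + α) / (p - 1)))) =
      r ^ ((p + α) / (p - 1)) / (1 + r ^ ((p + α) / (p - 1))) ^ 2 := by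
    field_simp; ring
  have h2 : r ^ α * r ^ ((p + α) / (p * (p - 1)) - k) =
      r ^ ((p + α) / (p - 1)) * r ^ (α * (p - 1) / p + 1 - k) / r ^ 2 := by
    rw [← rpow_add hr, ← rpow_add hr, ← rpow_two, ← rpow_sub hr]
    congr 1
    field_simp; ring
  have h3 : ((1 + r ^ ((p + α) / (p - 1))) ^ (-((N - p) / (p + α)))) ^ (pS N p α - 2) *
      (1 + r ^ ((p + α) / (p - 1))) ^ (-((N + α) / (p + α))) =
      (1 + r ^ ((p + α) / (p - 1))) ^ (-((N + α) / (p + α) * (p - 1))) /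
        (1 + r ^ ((p + α) / (p - 1))) ^ 2 := by
    rw [← rpow_mul hm.le, ← rpow_add hm, ← rpow_two (1 + _), ← rpow_sub hm]
    congr 1
    unfold pS
    field_simp; ring
  rw [h1]
  unfold Urad solProfile fluxGrad
  rw [mul_rpow hC.le (by positivity)]
  linear_combination
    (r ^ α * r ^ ((p + α) / (p * (p - 1)) - k)) *
      (((1 + r ^ ((p + α) / (p - 1))) ^ (-((N - p) / (p + α)))) ^ (pS N p α - 2) *
        (1 + r ^ ((p + α) / (p - 1))) ^ (-((N + α) / (p + α)))) * const_identity hp hpN hα +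
    gradConst N p α ^ (p - 2) * ((N + α) * (N * p + p * α - N + p) / (p - 1)) *
      (((1 + r ^ ((p + α) / (p - 1))) ^ (-((N - p) / (p + α)))) ^ (pS N p α - 2) *
        (1 + r ^ ((p + α) / (p - 1))) ^ (-((N + α) / (p + α)))) * h2 +
    gradConst N p α ^ (p - 2) * ((N + α) * (N * p + p * α - N + p) / (p - 1)) *
      (r ^ ((p + α) / (p - 1)) * r ^ (α * (p - 1) / p + 1 - k) / r ^ 2) * h3

/-- The radial equation solved by the profiles. -/
lemma exists_hasDerivAt_flux {k : ℝ}
    (hquad : (p - 1) * (α / p) ^ 2 + (N + p - 2) * (α / p) = (k - 1) * (k + N - 1))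
    {r : ℝ} (hr : 0 < r) :
    ∃ a' b' : ℝ, HasDerivAt (fluxGrad N p α k) a' r ∧ HasDerivAt (fluxRad N p α k) b' r ∧
      k * a' / r + b' * r + (k + N) * fluxRad N p α k r =
        -((pS N p α - 1) * (r ^ α * Urad N p α r ^ (pS N p α - 2) * solProfile N p α k r)) := by
  have hp1 : p - 1 ≠ 0 := by linarith
  have hpα : p + α ≠ 0 := by linarith
  have hp0 : p ≠ 0 := by linarith
  have ha := hasDerivAt_profile (gradConst N p α ^ (p - 2)) (α * (p - 1) / p + 1 - k)
    ((p + α) / (p - 1)) (-((N + α) / (p + α) * (p - 1))) hr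
  have hb := (hasDerivAt_profile (gradConst N p α ^ (p - 2)) (α * (p - 1) / p + 1 - k - 2)
    ((p + α) / (p - 1)) (-((N + α) / (p + α) * (p - 1))) hr).mul
    (((hasDerivAt_ratio ((p + α) / (p - 1)) hr).const_mul (N + α)).const_sub (1 + α / p - k))
  refine ⟨_, _, ha, hb, ?_⟩
  rw [source_eq hp hpN hα k hr]
  unfold fluxRad fluxGrad
  rw [rpow_sub hr _ 2, rpow_two]
  generalize r ^ ((p + α) / (p - 1)) / (1 + r ^ ((p + α) / (p - 1))) = t
  generalize gradConst N p α ^ (p - 2) = D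
  generalize r ^ (α * (p - 1) / p + 1 - k) = R
  generalize (1 + r ^ ((p + α) / (p - 1))) ^ (-((N + α) / (p + α) * (p - 1))) = M
  have hlin : -((N + α) / (p + α) * (p - 1)) * ((p + α) / (p - 1)) = -(N + α) := by
    field_simp
  rw [hlin]
  have hS : k * (α * (p - 1) / p + 1 - k - (N + α) * t) +
      (α * (p - 1) / p + 1 - k - 2 + k + N - (N + α) * t) * (1 + α / p - k - (N + α) * t) -
      (N + α) * ((p + α) / (p - 1)) * t * (1 - t) =
      -((N + α) * (N * p + p * α - N + p) / (p - 1) * (t * (1 - t))) := by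
    field_simp at hquad ⊢
    linear_combination (p - 1) * hquad
  have hr' := hr.ne'
  refine Eq.trans (b := D * R * M / r ^ 2 * (k * (α * (p - 1) / p + 1 - k - (N + α) * t) +
      (α * (p - 1) / p + 1 - k - 2 + k + N - (N + α) * t) * (1 + α / p - k - (N + α) * t) -
      (N + α) * ((p + α) / (p - 1)) * t * (1 - t))) ?_ (by rw [hS]; ring)
  generalize α * (p - 1) / p + 1 - k = A
  generalize (p + α) / (p - 1) = q
  generalize 1 + α / p - k = B
  field_simp
  ring

end Scalar

section Flux

variable {N k : ℕ} {p α : ℝ} {Φ : EuclideanSpace ℝ (Fin N) → ℝ}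

/-- The flux of the linearized operator at `U_α` applied to `solProfile * Φ`. -/
def linFlux (N k : ℕ) (p α : ℝ) (Φ : EuclideanSpace ℝ (Fin N) → ℝ)
    (x : EuclideanSpace ℝ (Fin N)) : EuclideanSpace ℝ (Fin N) :=
  fluxGrad N p α k ‖x‖ • gradient Φ x + (fluxRad N p α k ‖x‖ * Φ x) • x

lemma contDiffOn_linFlux (hΦ : ContDiff ℝ 2 Φ) :
    ContDiffOn ℝ 1 (linFlux N k p α Φ) {0}ᶜ := by
  intro x hx
  have hr : 0 < ‖x‖ := norm_pos_iff.2 hx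
  have hn : ContDiffAt ℝ 1 (fun y : EuclideanSpace ℝ (Fin N) => ‖y‖) x := contDiffAt_norm ℝ hx
  have ha : ContDiffAt ℝ 1 (fluxGrad N p α k) ‖x‖ := contDiffAt_profile _ _ _ _ hr
  have hb : ContDiffAt ℝ 1 (fluxRad N p α k) ‖x‖ :=
    (contDiffAt_profile _ _ _ _ hr).mul
      (contDiffAt_const.sub (contDiffAt_const.mul (contDiffAt_ratio _ hr)))
  have hΦ1 : ContDiff ℝ 1 Φ := hΦ.of_le (by norm_num)
  exact (((ha.comp x hn).smul (contDiff_gradient hΦ).contDiffAt).add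
    (((hb.comp x hn).mul hΦ1.contDiffAt).smul contDiffAt_id)).contDiffWithinAt

lemma contDiffAt_solProfile_mul {n : WithTop ℕ∞} (hΦ : ContDiff ℝ n Φ)
    {x : EuclideanSpace ℝ (Fin N)} (hx : x ≠ 0) :
    ContDiffAt ℝ n (fun x => solProfile N p α k ‖x‖ * Φ x) x := by
  have hn : ContDiffAt ℝ n (fun y : EuclideanSpace ℝ (Fin N) => ‖y‖) x := contDiffAt_norm ℝ hx
  have hw : ContDiffAt ℝ n (solProfile N p α k) ‖x‖ :=
    contDiffAt_profile _ _ _ _ (norm_pos_iff.2 hx)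
  exact (hw.comp x hn).mul hΦ.contDiffAt

lemma norm_linFlux_le (hp : 1 < p) (hpN : p < N) (hα : 0 ≤ α) (hk : 1 ≤ k) {M : ℝ} (hM : 0 ≤ M)
    {x : EuclideanSpace ℝ (Fin N)} (hx : x ≠ 0) (hΦ : |Φ x| ≤ M * ‖x‖ ^ k)
    (hΦ' : ‖fderiv ℝ Φ x‖ ≤ M * ‖x‖ ^ (k - 1)) :
    ‖linFlux N k p α Φ x‖ ≤ gradConst N p α ^ (p - 2) * M *
      (1 + (|1 + α / p - k| + (N + α))) * ‖x‖ ^ (α * (p - 1) / p) := by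
  have hr : 0 < ‖x‖ := norm_pos_iff.2 hx
  have hD := gradConst_pos hp hpN hα
  set r := ‖x‖
  set q := (p + α) / (p - 1)
  set D := gradConst N p α ^ (p - 2)
  have hD' : 0 < D := rpow_pos_of_pos hD _
  have hq : 0 < r ^ q := rpow_pos_of_pos hr _
  have hNα : 0 < N + α := by linarith
  have ht0 : 0 ≤ r ^ q / (1 + r ^ q) := by positivity
  have ht1 : r ^ q / (1 + r ^ q) ≤ 1 := by
    rw [div_le_one (by positivity)]; linarith
  have hm0 : 0 ≤ (1 + r ^ q) ^ (-((N + α) / (p + α) * (p - 1))) := by positivity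
  have hm1 : (1 + r ^ q) ^ (-((N + α) / (p + α) * (p - 1))) ≤ 1 := by
    apply rpow_le_one_of_one_le_of_nonpos (by linarith)
    have : 0 ≤ (N + α) / (p + α) * (p - 1) :=
      mul_nonneg (div_nonneg hNα.le (by linarith)) (by linarith)
    linarith
  have ha : |fluxGrad N p α k r| ≤ D * r ^ (α * (p - 1) / p + 1 - k) := by
    unfold fluxGrad
    rw [abs_of_nonneg (by positivity)]
    exact mul_le_of_le_one_right (by positivity) hm1
  have hb : |fluxRad N p α k r| ≤
      D * r ^ (α * (p - 1) / p + 1 - k - 2) * (|1 + α / p - k| + (N + α)) := by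
    unfold fluxRad
    rw [abs_mul, abs_of_nonneg (by positivity)]
    refine mul_le_mul (mul_le_of_le_one_right (by positivity) hm1) ?_ (abs_nonneg _)
      (by positivity)
    refine (abs_sub _ _).trans (add_le_add le_rfl ?_)
    rw [abs_of_nonneg (by positivity)]
    exact mul_le_of_le_one_right hNα.le ht1
  have e1 : r ^ (α * (p - 1) / p + 1 - k) * r ^ (k - 1) = r ^ (α * (p - 1) / p) := by
    rw [← rpow_natCast, ← rpow_add hr, Nat.cast_sub hk]
    congr 1; push_cast; ring
  have e2 : r ^ (α * (p - 1) / p + 1 - k - 2) * r ^ k * r = r ^ (α * (p - 1) / p) := by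
    rw [← rpow_natCast, ← rpow_add hr, ← rpow_add_one hr.ne']
    congr 1; ring
  have hgrad : ‖gradient Φ x‖ ≤ M * r ^ (k - 1) := by
    rwa [gradient, LinearIsometryEquiv.norm_map]
  calc ‖linFlux N k p α Φ x‖
      ≤ |fluxGrad N p α k r| * ‖gradient Φ x‖ + |fluxRad N p α k r| * |Φ x| * r := by
        refine (norm_add_le _ _).trans ?_
        rw [norm_smul, norm_smul, norm_mul]
        rfl
    _ ≤ D * r ^ (α * (p - 1) / p + 1 - k) * (M * r ^ (k - 1)) +
        D * r ^ (α * (p - 1) / p + 1 - k - 2) * (|1 + α / p - k| + (N + α)) *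
          (M * r ^ k) * r := by gcongr
    _ = D * M * (r ^ (α * (p - 1) / p + 1 - k) * r ^ (k - 1)) +
        D * M * (|1 + α / p - k| + (N + α)) *
          (r ^ (α * (p - 1) / p + 1 - k - 2) * r ^ k * r) := by ring
    _ = _ := by rw [e1, e2]; ring

lemma divTrace_fderiv_linFlux (hp : 1 < p) (hpN : p < N) (hα : 0 ≤ α)
    (hquad : (p - 1) * (α / p) ^ 2 + (N + p - 2) * (α / p) = ((k : ℝ) - 1) * (k + N - 1))
    (hΦ : ContDiff ℝ 2 Φ)
    (hhom : ∀ (c : ℝ) (x : EuclideanSpace ℝ (Fin N)), Φ (c • x) = c ^ k * Φ x)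
    (hharm : ∀ x : EuclideanSpace ℝ (Fin N),
      ∑ i : Fin N, fderiv ℝ (fun y => fderiv ℝ Φ y (EuclideanSpace.single i 1)) x
        (EuclideanSpace.single i 1) = 0)
    {x : EuclideanSpace ℝ (Fin N)} (hx : x ≠ 0) :
    divTrace (fderiv ℝ (linFlux N k p α Φ) x) =
      -((pS N p α - 1) * (‖x‖ ^ α * Ufun N p α x ^ (pS N p α - 2) *
        (solProfile N p α k ‖x‖ * Φ x))) := by
  obtain ⟨a', b', ha, hb, h⟩ := exists_hasDerivAt_flux hp hpN hα hquad (norm_pos_iff.2 hx)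
  unfold linFlux
  rw [divTrace_fderiv_radial_field hΦ hhom hharm hx ha hb, h, Ufun]
  ring

lemma linearized_flux_eq_inner_linFlux (hp : 1 < p) (hpN : p < N) (hα : 0 ≤ α)
    (hΦ : Differentiable ℝ Φ)
    (hhom : ∀ (c : ℝ) (x : EuclideanSpace ℝ (Fin N)), Φ (c • x) = c ^ k * Φ x)
    {x : EuclideanSpace ℝ (Fin N)} (hx : x ≠ 0) (e : EuclideanSpace ℝ (Fin N)) :
    ‖gradient (Ufun N p α) x‖ ^ (p - 2) *
        ⟪gradient (fun x => solProfile N p α k ‖x‖ * Φ x) x, e⟫ +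
      (p - 2) * ‖gradient (Ufun N p α) x‖ ^ (p - 4) *
        (⟪gradient (Ufun N p α) x, gradient (fun x => solProfile N p α k ‖x‖ * Φ x) x⟫ *
          ⟪gradient (Ufun N p α) x, e⟫) = ⟪linFlux N k p α Φ x, e⟫ := by
  have hr : 0 < ‖x‖ := norm_pos_iff.2 hx
  have hg := gradProfile_pos hp hpN hα hr
  have hU : gradient (Ufun N p α) x = (-gradProfile N p α ‖x‖ / ‖x‖) • x :=
    gradient_comp_norm hx (hasDerivAt_Urad hp hα hr)
  have hUn : ‖gradient (Ufun N p α) x‖ = gradProfile N p α ‖x‖ := by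
    rw [hU, norm_smul, norm_div, norm_neg, norm_norm, Real.norm_of_nonneg hg.le,
      div_mul_cancel₀ _ hr.ne']
  have hv := gradient_comp_norm_mul hx (hasDerivAt_solProfile N p α k hr) (hΦ x)
  have hE : ⟪x, gradient Φ x⟫ = k * Φ x := by
    rw [real_inner_comm, inner_gradient_left, fderiv_apply_self_of_homogeneous hhom (hΦ x)]
  have h4 : gradProfile N p α ‖x‖ ^ (p - 4) =
      gradProfile N p α ‖x‖ ^ (p - 2) / gradProfile N p α ‖x‖ ^ 2 := by
    rw [← rpow_two, ← rpow_sub hg]; congr 1; ring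
  rw [hUn, hU, hv, h4]
  unfold linFlux
  rw [fluxRad_eq hp hα k hr, ← gradProfile_rpow_mul_solProfile hp hpN hα k hr]
  simp only [inner_add_left, inner_add_right, real_inner_smul_left, real_inner_smul_right, hE,
    real_inner_self_eq_norm_sq]
  have hr' := hr.ne'
  have hg' := hg.ne'
  field_simp
  ring

end Flux

section Solution

variable {N k : ℕ} {p α : ℝ} {Φ : EuclideanSpace ℝ (Fin N) → ℝ}

lemma continuous_Ufun (hp : 1 < p) (hpN : p < N) (hα : 0 ≤ α) : Continuous (Ufun N p α) := by
  have hq : 0 ≤ (p + α) / (p - 1) := div_nonneg (by linarith) (by linarith)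
  unfold Ufun Urad
  refine continuous_const.mul (Continuous.rpow_const
    (continuous_const.add (continuous_norm.rpow_const fun _ => Or.inr hq)) fun x => Or.inl ?_)
  positivity

/-- The explicit solution is `solProfile * Φ` away from the origin. -/
lemma angular_form_eq_solProfile_mul
    (hhom : ∀ (c : ℝ) (x : EuclideanSpace ℝ (Fin N)), Φ (c • x) = c ^ k * Φ x)
    {x : EuclideanSpace ℝ (Fin N)} (hx : x ≠ 0) :
    ‖x‖ ^ ((p + α) / (p * (p - 1))) *
        (1 + ‖x‖ ^ ((p + α) / (p - 1))) ^ (-(((N : ℝ) + α) / (p + α))) * Φ (‖x‖⁻¹ • x) =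
      solProfile N p α k ‖x‖ * Φ x := by
  have hr : 0 < ‖x‖ := norm_pos_iff.2 hx
  rw [hhom, solProfile, rpow_sub hr, rpow_natCast, inv_pow]
  field_simp

lemma abs_solProfile_mul_le (hp : 1 < p) (hpN : p < N) (hα : 0 ≤ α) {M : ℝ}
    {x : EuclideanSpace ℝ (Fin N)} (hx : x ≠ 0) (hΦ : |Φ x| ≤ M * ‖x‖ ^ k) :
    |solProfile N p α k ‖x‖ * Φ x| ≤ M * ‖x‖ ^ ((p + α) / (p * (p - 1))) := by
  have hr : 0 < ‖x‖ := norm_pos_iff.2 hx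
  have hm : (1 + ‖x‖ ^ ((p + α) / (p - 1))) ^ (-((N + α) / (p + α))) ≤ 1 := by
    apply rpow_le_one_of_one_le_of_nonpos
    · have := rpow_nonneg hr.le ((p + α) / (p - 1))
      linarith
    · have : 0 ≤ (N + α) / (p + α) := div_nonneg (by linarith) (by linarith)
      linarith
  have hw : |solProfile N p α k ‖x‖| ≤ ‖x‖ ^ ((p + α) / (p * (p - 1)) - k) := by
    unfold solProfile
    rw [one_mul, abs_of_nonneg (by positivity)]
    exact mul_le_of_le_one_right (by positivity) hm
  calc |solProfile N p α k ‖x‖ * Φ x|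
      ≤ ‖x‖ ^ ((p + α) / (p * (p - 1)) - k) * (M * ‖x‖ ^ k) := by
        rw [abs_mul]
        exact mul_le_mul hw hΦ (abs_nonneg _) (by positivity)
    _ = M * ‖x‖ ^ ((p + α) / (p * (p - 1))) := by
        rw [rpow_sub hr, rpow_natCast]
        field_simp

lemma continuous_of_eq_solProfile_mul (hp : 1 < p) (hpN : p < N) (hα : 0 ≤ α)
    {v : EuclideanSpace ℝ (Fin N) → ℝ} (h0 : v 0 = 0)
    (hv : ∀ x ≠ 0, v x = solProfile N p α k ‖x‖ * Φ x)
    (hvd : ContDiffOn ℝ 1 v {x | x ≠ 0}) {M : ℝ} (hM : ∀ x ≠ 0, |Φ x| ≤ M * ‖x‖ ^ k) :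
    Continuous v := by
  rw [continuous_iff_continuousAt]
  intro x
  by_cases hx : x = 0
  · subst hx
    have hs : 0 < (p + α) / (p * (p - 1)) :=
      div_pos (by linarith) (mul_pos (by linarith) (by linarith))
    have hB : Continuous fun x : EuclideanSpace ℝ (Fin N) =>
        M * ‖x‖ ^ ((p + α) / (p * (p - 1))) :=
      continuous_const.mul (continuous_norm.rpow_const fun _ => Or.inr hs.le)
    have hlim := hB.tendsto 0
    rw [norm_zero, zero_rpow hs.ne', mul_zero] at hlim
    rw [ContinuousAt, h0]
    refine squeeze_zero_norm (fun y => ?_) hlim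
    by_cases hy : y = 0
    · simp [hy, h0, zero_rpow hs.ne']
    · rw [hv y hy]
      exact abs_solProfile_mul_le hp hpN hα hy (hM y hy)
  · exact (hvd.continuousOn.continuousAt (isOpen_ne.mem_nhds hx))

end Solution

/-- For `α = α(k)` and `Φ` a nonzero harmonic polynomial homogeneous of
degree `k`, the function
`v(x) = |x|^{(p+α)/(p(p-1))}(1 + |x|^{(p+α)/(p-1)})^{-(N+α)/(p+α)} Φ(x/|x|)` (with
`v(0) = 0`) is continuous on `ℝ^N`, `C¹` away from the origin, and is a weak solution of
the linearized equation at `U_α`, all integrals being absolutely convergent. -/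
theorem stmt_15 (N : ℕ) (hN : 2 ≤ N) (p : ℝ) (hp1 : 1 < p) (hpN : p < N)
    (k : ℕ) (hk : 1 ≤ k) (Φ : EuclideanSpace ℝ (Fin N) → ℝ)
    (hpoly : ∃ P : MvPolynomial (Fin N) ℝ, ∀ x : EuclideanSpace ℝ (Fin N),
      Φ x = MvPolynomial.eval (fun i => x i) P)
    (hhom : ∀ (c : ℝ) (x : EuclideanSpace ℝ (Fin N)), Φ (c • x) = c ^ k * Φ x)
    (hharm : ∀ x : EuclideanSpace ℝ (Fin N),
      ∑ i : Fin N, fderiv ℝ (fun y => fderiv ℝ Φ y (EuclideanSpace.single i 1)) x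
        (EuclideanSpace.single i 1) = 0)
    (hne : Φ ≠ 0) :
    ∀ (α : ℝ) (v : EuclideanSpace ℝ (Fin N) → ℝ),
      α = alphaK N p k →
      (v = fun x => if x = 0 then 0 else
        ‖x‖ ^ ((p + α) / (p * (p - 1))) *
          (1 + ‖x‖ ^ ((p + α) / (p - 1))) ^ (-(((N : ℝ) + α) / (p + α))) *
          Φ (‖x‖⁻¹ • x)) →
      Continuous v ∧ ContDiffOn ℝ 1 v {x | x ≠ 0} ∧
      ∀ φ : EuclideanSpace ℝ (Fin N) → ℝ, ContDiff ℝ (⊤ : ℕ∞) φ → HasCompactSupport φ →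
        Integrable (fun x =>
          ‖gradient (Ufun N p α) x‖ ^ (p - 2) * ⟪gradient v x, gradient φ x⟫ +
          (p - 2) * ‖gradient (Ufun N p α) x‖ ^ (p - 4) *
            (⟪gradient (Ufun N p α) x, gradient v x⟫ *
              ⟪gradient (Ufun N p α) x, gradient φ x⟫)) ∧
        Integrable (fun x : EuclideanSpace ℝ (Fin N) =>
          ‖x‖ ^ α * (Ufun N p α x) ^ (pS N p α - 2) * v x * φ x) ∧
        (∫ x, (‖gradient (Ufun N p α) x‖ ^ (p - 2) * ⟪gradient v x, gradient φ x⟫ +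
            (p - 2) * ‖gradient (Ufun N p α) x‖ ^ (p - 4) *
              (⟪gradient (Ufun N p α) x, gradient v x⟫ *
                ⟪gradient (Ufun N p α) x, gradient φ x⟫))) =
          (pS N p α - 1) * ∫ x : EuclideanSpace ℝ (Fin N),
            ‖x‖ ^ α * (Ufun N p α x) ^ (pS N p α - 2) * v x * φ x := by
  intro α v hα hv
  obtain ⟨P, hP⟩ := hpoly
  have hΦ : ∀ n : WithTop ℕ∞, ContDiff ℝ n Φ := fun n => by
    rw [funext hP]
    exact contDiff_mvPolynomial_eval P
  have hN' : (2 : ℝ) ≤ N := by exact_mod_cast hN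
  have : Nonempty (Fin N) := ⟨⟨0, by omega⟩⟩
  have hα0 : 0 ≤ α := hα ▸ alphaK_nonneg hN' hp1 hk
  have hquad := alphaK_quadratic hN' hp1 hk
  rw [← hα] at hquad
  obtain ⟨M, hM0, hM⟩ := exists_bound_of_homogeneous hk hhom (hΦ 1)
  have hvx : ∀ x ≠ 0, v x = solProfile N p α k ‖x‖ * Φ x := fun x hx => by
    rw [hv]
    simp only [if_neg hx]
    exact angular_form_eq_solProfile_mul hhom hx
  have hev : ∀ x ≠ 0, v =ᶠ[nhds x] fun x => solProfile N p α k ‖x‖ * Φ x := fun x hx =>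
    Filter.eventually_of_mem (isOpen_ne.mem_nhds hx) hvx
  have hvd : ContDiffOn ℝ 1 v {x | x ≠ 0} := fun x hx =>
    ((contDiffAt_solProfile_mul (hΦ 1) hx).congr_of_eventuallyEq (hev x hx)).contDiffWithinAt
  have hvc : Continuous v := continuous_of_eq_solProfile_mul hp1 hpN hα0 (by simp [hv]) hvx hvd
    fun x hx => (hM x hx).1
  refine ⟨hvc, hvd, fun φ hφ hφc => ?_⟩
  have hg : Continuous fun x : EuclideanSpace ℝ (Fin N) =>
      ‖x‖ ^ α * (Ufun N p α x) ^ (pS N p α - 2) * v x :=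
    ((continuous_norm.rpow_const fun _ => Or.inr hα0).mul
      ((continuous_Ufun hp1 hpN hα0).rpow_const fun x =>
        Or.inl (Urad_pos hp1 hpN hα0 (norm_nonneg x)).ne')).mul hvc
  have hγ : 0 ≤ α * (p - 1) / p :=
    div_nonneg (mul_nonneg hα0 (by linarith)) (by linarith)
  obtain ⟨hInt, heq⟩ := integral_fderiv_apply_eq_neg_of_punctured hN
    (contDiffOn_linFlux (N := N) (k := k) (p := p) (α := α) (hΦ 2))
    (continuous_const.mul (continuous_norm.rpow_const fun _ => Or.inr hγ))
    (fun x hx => norm_linFlux_le hp1 hpN hα0 hk hM0 hx (hM x hx).1 (hM x hx).2)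
    (continuous_const.mul hg : Continuous fun x : EuclideanSpace ℝ (Fin N) =>
      -(pS N p α - 1) * (‖x‖ ^ α * (Ufun N p α x) ^ (pS N p α - 2) * v x))
    (fun x hx => by
      simp only [divTrace_fderiv_linFlux hp1 hpN hα0 hquad (hΦ 2) hhom hharm hx, Pi.mul_apply,
        hvx x hx]
      ring)
    (hφ.of_le (by exact_mod_cast le_top)) hφc
  have hae : (fun x => ‖gradient (Ufun N p α) x‖ ^ (p - 2) * ⟪gradient v x, gradient φ x⟫ +
      (p - 2) * ‖gradient (Ufun N p α) x‖ ^ (p - 4) *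
        (⟪gradient (Ufun N p α) x, gradient v x⟫ *
          ⟪gradient (Ufun N p α) x, gradient φ x⟫)) =ᵐ[volume]
      fun x => fderiv ℝ φ x (linFlux N k p α Φ x) := by
    have h0 : ∀ᵐ x : EuclideanSpace ℝ (Fin N), x ≠ 0 := by simp [ae_iff]
    filter_upwards [h0] with x hx
    rw [(hev x hx).gradient_eq, linearized_flux_eq_inner_linFlux hp1 hpN hα0
      ((hΦ 1).differentiable one_ne_zero) hhom hx, inner_gradient_right]
    simp
  refine ⟨hInt.congr hae.symm, (hg.mul hφ.continuous).integrable_of_hasCompactSupport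
    hφc.mul_left, ?_⟩
  rw [integral_congr_ae hae, heq, ← integral_neg, ← integral_const_mul]
  congr 1 with x
  simp only [Pi.mul_apply]
  ring
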